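/- Let (H, ⟨·,·⟩) be a real Hilbert space and A : H → H a bounded self-adjoint linear operator which is an isomorphism (bijective with bounded inverse). Suppose there exists a closed subspace W₁ ⊆ H of finite codimension q₀ and c₀ > 0 such that ⟨Av, v⟩ ≥ c₀ ‖v‖² for all v ∈ W₁. Then there exist c₁ > 0 and an orthogonal decomposition H = W₋ ⊕ W₊ with dim W₋ =: q ≤ q₀ finite, such that ⟨Av, v⟩ ≤ −c₁‖v‖² for all v ∈ W₋ and ⟨Av, v⟩ ≥ c₁‖v‖² for all v ∈ W₊. Moreover W₋ can be chosen as the span of finitely many eigenvectors of A with negative eigenvalues. -/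

import Mathlib

open RealInnerProductSpace

open Filter Topology

section CoercivityOnInvariantSubspaces

variable {H : Type*} [NormedAddCommGroup H] [InnerProductSpace ℝ H]

/-- A symmetric operator `B` which is nonnegative on an invariant subspace `K` satisfies
`‖B v‖² ≤ (‖B‖ + 1) ⟪B v, v⟫` on `K`. -/
lemma norm_sq_apply_le_of_nonneg_on {B : H →L[ℝ] H} (hB : ∀ x y, ⟪B x, y⟫ = ⟪x, B y⟫)
    {K : Submodule ℝ H} (hK : ∀ v ∈ K, B v ∈ K) (hpos : ∀ v ∈ K, 0 ≤ ⟪B v, v⟫)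
    {v : H} (hv : v ∈ K) : ‖B v‖ ^ 2 ≤ (‖B‖ + 1) * ⟪B v, v⟫ := by
  set M := ‖B‖ + 1 with hM
  have hM0 : 0 < M := by positivity
  have h := hpos _ (K.sub_mem (K.smul_mem M hv) (hK v hv))
  have hBB : ⟪B (B v), B v⟫ ≤ M * ‖B v‖ ^ 2 := by
    calc ⟪B (B v), B v⟫ ≤ ‖B (B v)‖ * ‖B v‖ := real_inner_le_norm _ _
      _ ≤ (‖B‖ * ‖B v‖) * ‖B v‖ := by gcongr; exact B.le_opNorm _
      _ ≤ M * ‖B v‖ ^ 2 := by rw [hM]; nlinarith [sq_nonneg ‖B v‖]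
  have hexp : ⟪B (M • v - B v), M • v - B v⟫
      = M ^ 2 * ⟪B v, v⟫ - 2 * M * ‖B v‖ ^ 2 + ⟪B (B v), B v⟫ := by
    simp only [map_sub, map_smul, inner_sub_left, inner_sub_right, real_inner_smul_left,
      real_inner_smul_right, hB (B v) v, real_inner_self_eq_norm_sq]
    ring
  rw [hexp] at h
  have : 0 ≤ M * (M * ⟪B v, v⟫ - ‖B v‖ ^ 2) := by nlinarith
  have := nonneg_of_mul_nonneg_right this hM0
  linarith

/-- A bounded sequence of approximate null vectors of an operator which is coercive on a closed
subspace with finite-dimensional orthogonal complement has a convergent subsequence. -/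
lemma exists_subseq_tendsto_of_coercive [CompleteSpace H] {B : H →L[ℝ] H} {W : Submodule ℝ H}
    (hW : IsClosed (W : Set H)) [FiniteDimensional ℝ Wᗮ] {c : ℝ} (hc : 0 < c)
    (hcoer : ∀ v ∈ W, c * ‖v‖ ^ 2 ≤ ⟪B v, v⟫) {u : ℕ → H} (hu : ∀ n, ‖u n‖ ≤ 1)
    (hBu : Tendsto (fun n => B (u n)) atTop (𝓝 0)) :
    ∃ v, ∃ φ : ℕ → ℕ, StrictMono φ ∧ Tendsto (u ∘ φ) atTop (𝓝 v) := by
  have : CompleteSpace W := hW.completeSpace_coe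
  have hbelow : ∀ v ∈ W, c * ‖v‖ ≤ ‖B v‖ := by
    intro v hv
    rcases (norm_nonneg v).eq_or_lt with h0 | h0
    · rw [← h0]; simp
    · have := (hcoer v hv).trans (real_inner_le_norm _ _)
      exact le_of_mul_le_mul_right (by linarith) h0
  obtain ⟨f, -, φ, hφ, hf⟩ := tendsto_subseq_of_bounded
    (x := fun n => Wᗮ.orthogonalProjectionOnto (u n))
    (Metric.isBounded_closedBall (x := (0 : Wᗮ)) (r := 1)) (fun n => by
      rw [mem_closedBall_zero_iff]
      exact (Wᗮ.norm_orthogonalProjectionOnto_apply_le (u n)).trans (hu n))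
  have hf' : Tendsto (fun n => (Wᗮ.orthogonalProjectionOnto (u (φ n)) : H)) atTop (𝓝 (f : H)) :=
    (continuous_subtype_val.tendsto f).comp hf
  have hdecomp : ∀ x : H, (W.orthogonalProjectionOnto x : H) + Wᗮ.orthogonalProjectionOnto x = x := by
    intro x
    exact W.starProjection_add_starProjection_orthogonal x
  have hBw : CauchySeq (fun n => B (W.orthogonalProjectionOnto (u (φ n)) : H)) := by
    have h := (hBu.comp hφ.tendsto_atTop).sub ((B.continuous.tendsto _).comp hf')
    refine (h.congr fun n => ?_).cauchySeq
    simp only [Function.comp_apply]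
    rw [← map_sub, sub_eq_of_eq_add (hdecomp (u (φ n))).symm]
  have hw : CauchySeq (fun n => (W.orthogonalProjectionOnto (u (φ n)) : H)) := by
    rw [Metric.cauchySeq_iff] at hBw ⊢
    intro ε hε
    obtain ⟨N, hN⟩ := hBw (c * ε) (by positivity)
    refine ⟨N, fun m hm n hn => ?_⟩
    have h1 := hN m hm n hn
    rw [dist_eq_norm, ← map_sub] at h1
    rw [dist_eq_norm]
    have h2 := hbelow _ (W.sub_mem (W.orthogonalProjectionOnto (u (φ m))).2
      (W.orthogonalProjectionOnto (u (φ n))).2)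
    exact lt_of_mul_lt_mul_left (h2.trans_lt h1) hc.le
  obtain ⟨w, hw⟩ := cauchySeq_tendsto_of_complete hw
  refine ⟨w + f, φ, hφ, (hw.add hf').congr fun n => hdecomp _⟩

/-- An injective symmetric operator, coercive on a closed subspace with finite-dimensional
orthogonal complement, is either coercive on a given closed invariant subspace `K` or has an
eigenvector with negative eigenvalue in `K`. -/
lemma coercive_on_or_exists_neg_eigenvector [CompleteSpace H] {A : H →L[ℝ] H}
    (hA : ∀ x y, ⟪A x, y⟫ = ⟪x, A y⟫) (hinj : Function.Injective A) {W : Submodule ℝ H}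
    (hW : IsClosed (W : Set H)) [FiniteDimensional ℝ Wᗮ] {c : ℝ} (hc : 0 < c)
    (hcoer : ∀ v ∈ W, c * ‖v‖ ^ 2 ≤ ⟪A v, v⟫) {K : Submodule ℝ H}
    (hKcl : IsClosed (K : Set H)) (hK : ∀ v ∈ K, A v ∈ K) :
    (∃ d : ℝ, 0 < d ∧ ∀ v ∈ K, d * ‖v‖ ^ 2 ≤ ⟪A v, v⟫) ∨
      ∃ v ∈ K, v ≠ 0 ∧ ∃ μ : ℝ, μ < 0 ∧ A v = μ • v := by
  set S : Set ℝ := (fun v => ⟪A v, v⟫) '' {v | v ∈ K ∧ ‖v‖ = 1} with hS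
  have hbdd : BddBelow S := by
    refine ⟨-‖A‖, ?_⟩
    rintro _ ⟨v, ⟨-, hv⟩, rfl⟩
    have h1 := abs_real_inner_le_norm (A v) v
    have h2 := A.le_opNorm v
    rw [hv, mul_one] at h1 h2
    exact (abs_le.1 (h1.trans h2)).1
  have hray : ∀ v ∈ K, sInf S * ‖v‖ ^ 2 ≤ ⟪A v, v⟫ := by
    intro v hv
    rcases eq_or_ne v 0 with rfl | h0
    · simp
    have hn : 0 < ‖v‖ := norm_pos_iff.2 h0
    have := csInf_le hbdd ⟨‖v‖⁻¹ • v, ⟨K.smul_mem _ hv, by simp [norm_smul, hn.ne']⟩, rfl⟩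
    simp only [map_smul, real_inner_smul_left, real_inner_smul_right] at this
    calc sInf S * ‖v‖ ^ 2 ≤ (‖v‖⁻¹ * (‖v‖⁻¹ * ⟪A v, v⟫)) * ‖v‖ ^ 2 := by gcongr
      _ = ⟪A v, v⟫ := by field_simp
  rcases S.eq_empty_or_nonempty with hemp | hne
  · left
    refine ⟨1, one_pos, fun v hv => ?_⟩
    rcases eq_or_ne v 0 with rfl | h0
    · simp
    have : ⟪A (‖v‖⁻¹ • v), ‖v‖⁻¹ • v⟫ ∈ S :=
      ⟨‖v‖⁻¹ • v, ⟨K.smul_mem _ hv, by simp [norm_smul, h0]⟩, rfl⟩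
    simp [hemp] at this
  rcases lt_or_ge 0 (sInf S) with hm | hm
  · exact Or.inl ⟨_, hm, hray⟩
  right
  set m := sInf S
  have hex : ∀ n : ℕ, ∃ v, v ∈ K ∧ ‖v‖ = 1 ∧ ⟪A v, v⟫ < m + 1 / ((n : ℝ) + 1) := by
    intro n
    obtain ⟨_, ⟨v, ⟨hv, hv1⟩, rfl⟩, h⟩ :=
      exists_lt_of_csInf_lt hne (lt_add_of_pos_right m (Nat.one_div_pos_of_nat (α := ℝ) (n := n)))
    exact ⟨v, hv, hv1, h⟩
  choose u huK hu1 hu using hex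
  set B : H →L[ℝ] H := A - m • ContinuousLinearMap.id ℝ H with hBdef
  have hBapp : ∀ v, B v = A v - m • v := fun v => by simp [hBdef]
  have hBin : ∀ v, ⟪B v, v⟫ = ⟪A v, v⟫ - m * ‖v‖ ^ 2 := fun v => by
    rw [hBapp, inner_sub_left, real_inner_smul_left, real_inner_self_eq_norm_sq]
  have hBsq : ∀ n, ‖B (u n)‖ ^ 2 ≤ (‖B‖ + 1) * (1 / ((n : ℝ) + 1)) := by
    intro n
    refine (norm_sq_apply_le_of_nonneg_on (K := K) ?_ ?_ ?_ (huK n)).trans ?_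
    · intro x y
      simp only [hBapp, inner_sub_left, inner_sub_right, real_inner_smul_left,
        real_inner_smul_right, hA]
    · intro v hv
      rw [hBapp]
      exact K.sub_mem (hK v hv) (K.smul_mem _ hv)
    · intro v hv
      rw [hBin]
      linarith [hray v hv]
    · gcongr
      rw [hBin, hu1]
      linarith [hu n]
  have hBu : Tendsto (fun n => B (u n)) atTop (𝓝 0) := by
    have h1 : Tendsto (fun n : ℕ => (‖B‖ + 1) * (1 / ((n : ℝ) + 1))) atTop (𝓝 0) := by
      simpa using tendsto_one_div_add_atTop_nhds_zero_nat.const_mul (‖B‖ + 1)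
    have h2 := (squeeze_zero (fun n => sq_nonneg _) hBsq h1).sqrt
    rw [tendsto_zero_iff_norm_tendsto_zero]
    simpa using h2
  obtain ⟨v, φ, hφ, hv⟩ := exists_subseq_tendsto_of_coercive hW hc (B := B)
    (fun w hw => by rw [hBin]; nlinarith [hcoer w hw, sq_nonneg ‖w‖]) (fun n => (hu1 n).le) hBu
  have hv1 : ‖v‖ = 1 :=
    tendsto_nhds_unique hv.norm (by simp [hu1])
  have hv0 : v ≠ 0 := norm_ne_zero_iff.1 (by simp [hv1])
  have hBv : B v = 0 :=
    tendsto_nhds_unique ((B.continuous.tendsto v).comp hv) (hBu.comp hφ.tendsto_atTop)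
  have hAv : A v = m • v := by rwa [hBapp, sub_eq_zero] at hBv
  refine ⟨v, hKcl.mem_of_tendsto hv (Eventually.of_forall fun n => huK _), hv0, m, ?_, hAv⟩
  refine lt_of_le_of_ne hm fun h0 => hv0 (hinj ?_)
  rw [hAv, h0, zero_smul, map_zero]

/-- A subspace on which `A` is negative definite has dimension at most the codimension of any
subspace on which `A` is nonnegative. -/
lemma finrank_le_finrank_quotient_of_neg {A : H →L[ℝ] H} {V W : Submodule ℝ H}
    [FiniteDimensional ℝ (H ⧸ W)] {c : ℝ} (hc : 0 < c)
    (hneg : ∀ v ∈ V, ⟪A v, v⟫ ≤ -c * ‖v‖ ^ 2) (hpos : ∀ v ∈ W, 0 ≤ ⟪A v, v⟫) :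
    Module.finrank ℝ V ≤ Module.finrank ℝ (H ⧸ W) := by
  refine LinearMap.finrank_le_finrank_of_injective (f := W.mkQ ∘ₗ V.subtype) ?_
  rw [injective_iff_map_eq_zero]
  intro v hv
  have hvW : (v : H) ∈ W := by simpa using hv
  have h1 := hneg v v.2
  have h2 := hpos v hvW
  have h3 : ‖(v : H)‖ ^ 2 ≤ 0 := by
    by_contra! h
    nlinarith
  exact Subtype.ext (by simpa using le_antisymm h3 (sq_nonneg _))

/-- Adjoining to a subspace, on which `A` is negative definite, an orthogonal eigenvector with
negative eigenvalue keeps `A` negative definite. -/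
lemma exists_neg_on_sup_span_singleton {A : H →L[ℝ] H} (hA : ∀ x y, ⟪A x, y⟫ = ⟪x, A y⟫)
    {V : Submodule ℝ H} {c : ℝ} (hc : 0 < c) (hneg : ∀ v ∈ V, ⟪A v, v⟫ ≤ -c * ‖v‖ ^ 2)
    {x : H} (hx : x ∈ Vᗮ) {μ : ℝ} (hμ : μ < 0) (hAx : A x = μ • x) :
    ∃ d : ℝ, 0 < d ∧ ∀ v ∈ V ⊔ ℝ ∙ x, ⟪A v, v⟫ ≤ -d * ‖v‖ ^ 2 := by
  refine ⟨min c (-μ), lt_min hc (neg_pos.2 hμ), fun v hv => ?_⟩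
  obtain ⟨y, hy, z, hz, rfl⟩ := Submodule.mem_sup.1 hv
  obtain ⟨t, rfl⟩ := Submodule.mem_span_singleton.1 hz
  have hyx : ⟪y, x⟫ = 0 := hx y hy
  have hxy : ⟪x, y⟫ = 0 := by rw [real_inner_comm, hyx]
  have h1 : ⟪A (y + t • x), y + t • x⟫ = ⟪A y, y⟫ + μ * (t ^ 2 * ‖x‖ ^ 2) := by
    simp only [map_add, map_smul, hAx, inner_add_left, inner_add_right, real_inner_smul_left,
      real_inner_smul_right, hA y x, hyx, hxy, real_inner_self_eq_norm_sq]
    ring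
  have h2 : ‖y + t • x‖ ^ 2 = ‖y‖ ^ 2 + t ^ 2 * ‖x‖ ^ 2 := by
    rw [← real_inner_self_eq_norm_sq]
    simp only [inner_add_left, inner_add_right, real_inner_smul_left,
      real_inner_smul_right, hyx, hxy, real_inner_self_eq_norm_sq, norm_smul, mul_pow,
      Real.norm_eq_abs, sq_abs]
    ring
  rw [h1, h2]
  nlinarith [hneg y hy,
    mul_le_mul_of_nonneg_right (min_le_left c (-μ)) (sq_nonneg ‖y‖),
    mul_le_mul_of_nonneg_right (min_le_right c (-μ)) (mul_nonneg (sq_nonneg t) (sq_nonneg ‖x‖))]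

/-- The orthogonal complement of a span of eigenvectors of a symmetric operator is invariant. -/
lemma apply_mem_orthogonal_span_of_eigenvectors {A : H →L[ℝ] H}
    (hA : ∀ x y, ⟪A x, y⟫ = ⟪x, A y⟫) {s : Set H} (hs : ∀ x ∈ s, ∃ μ : ℝ, A x = μ • x)
    {v : H} (hv : v ∈ (Submodule.span ℝ s)ᗮ) : A v ∈ (Submodule.span ℝ s)ᗮ := by
  rw [Submodule.mem_orthogonal] at hv ⊢
  intro y hy
  rw [← hA]
  refine hv _ ?_
  have : Submodule.span ℝ s ≤ (Submodule.span ℝ s).comap A.toLinearMap := by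
    rw [Submodule.span_le]
    intro x hx
    obtain ⟨μ, h⟩ := hs x hx
    simpa [h] using Submodule.smul_mem _ μ (Submodule.subset_span hx)
  exact this hy

end CoercivityOnInvariantSubspaces

/-- a bounded self-adjoint isomorphism of a real Hilbert space which is
coercive on a closed subspace of finite codimension `q₀` admits an orthogonal
decomposition `H = W₋ ⊕ W₋ᗮ` with `dim W₋ ≤ q₀` finite, on which it is uniformly
negative resp. positive; moreover `W₋` is spanned by eigenvectors with negative
eigenvalues. -/
theorem stmt7 (H : Type*) [NormedAddCommGroup H] [InnerProductSpace ℝ H]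
    [CompleteSpace H]
    (A : H →L[ℝ] H) (hsa : IsSelfAdjoint A) (hbij : Function.Bijective A)
    (W₁ : Submodule ℝ H) (hW₁closed : IsClosed (W₁ : Set H))
    (q₀ : ℕ) [FiniteDimensional ℝ (H ⧸ W₁)]
    (hcodim : Module.finrank ℝ (H ⧸ W₁) = q₀)
    (c₀ : ℝ) (hc₀ : 0 < c₀)
    (hcoer : ∀ v ∈ W₁, c₀ * ‖v‖ ^ 2 ≤ ⟪A v, v⟫) :
    ∃ c₁ : ℝ, 0 < c₁ ∧ ∃ Wm : Submodule ℝ H,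
      FiniteDimensional ℝ Wm ∧ Module.finrank ℝ Wm ≤ q₀ ∧
      Wm ⊔ Wmᗮ = ⊤ ∧
      (∀ v ∈ Wm, ⟪A v, v⟫ ≤ -c₁ * ‖v‖ ^ 2) ∧
      (∀ v ∈ Wmᗮ, c₁ * ‖v‖ ^ 2 ≤ ⟪A v, v⟫) ∧
      (∃ s : Finset H, (∀ x ∈ s, ∃ μ : ℝ, μ < 0 ∧ A x = μ • x) ∧
        Wm = Submodule.span ℝ (s : Set H)) := by
  have hA : ∀ x y, ⟪A x, y⟫ = ⟪x, A y⟫ := hsa.isSymmetric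
  have : CompleteSpace W₁ := hW₁closed.completeSpace_coe
  have : FiniteDimensional ℝ W₁ᗮ :=
    (Submodule.quotientEquivOfIsCompl W₁ W₁ᗮ
      W₁.isCompl_orthogonal).finiteDimensional
  let P : ℕ → Prop := fun n => ∃ s : Finset H, (∀ x ∈ s, ∃ μ : ℝ, μ < 0 ∧ A x = μ • x) ∧
    (∃ c : ℝ, 0 < c ∧ ∀ v ∈ Submodule.span ℝ (s : Set H), ⟪A v, v⟫ ≤ -c * ‖v‖ ^ 2) ∧
    Module.finrank ℝ (Submodule.span ℝ (s : Set H)) = n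
  have hnonneg : ∀ v ∈ W₁, 0 ≤ ⟪A v, v⟫ := fun v hv => le_trans (by positivity) (hcoer v hv)
  have hbound : ∀ n, P n → n ≤ q₀ := by
    rintro n ⟨s, -, ⟨c, hc, hneg⟩, rfl⟩
    rw [← hcodim]
    exact finrank_le_finrank_quotient_of_neg hc hneg hnonneg
  classical
  have hP0 : P 0 := ⟨∅, by simp, ⟨1, one_pos, by simp⟩, by simp⟩
  obtain ⟨s, hs, ⟨c, hc, hneg⟩, hrank⟩ := Nat.findGreatest_spec (Nat.zero_le q₀) hP0
  set V := Submodule.span ℝ (s : Set H) with hV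
  have hVfin : FiniteDimensional ℝ V := FiniteDimensional.span_finset ℝ s
  rcases coercive_on_or_exists_neg_eigenvector hA hbij.injective hW₁closed hc₀ hcoer
    V.isClosed_orthogonal (fun v hv => apply_mem_orthogonal_span_of_eigenvectors hA
      (fun x hx => (hs x hx).imp fun _ h => h.2) hv) with ⟨d, hd, hpos⟩ | ⟨x, hxV, hx0, μ, hμ, hAx⟩
  · refine ⟨min c d, lt_min hc hd, V, hVfin, ?_, ?_, fun v hv => ?_, fun v hv => ?_, s, hs, hV⟩
    · rw [← hcodim]
      exact finrank_le_finrank_quotient_of_neg hc hneg hnonneg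
    · exact Submodule.sup_orthogonal_of_hasOrthogonalProjection
    · refine (hneg v hv).trans ?_
      gcongr
      exact min_le_left _ _
    · refine le_trans ?_ (hpos v hv)
      gcongr
      exact min_le_right _ _
  · exfalso
    have hspan : Submodule.span ℝ ((insert x s : Finset H) : Set H) = V ⊔ ℝ ∙ x := by
      rw [Finset.coe_insert, Submodule.span_insert, sup_comm]
    have hlt : V < V ⊔ ℝ ∙ x := by
      refine lt_of_le_of_ne le_sup_left fun h => hx0 ?_
      have hx : x ∈ V := h ▸ Submodule.mem_sup_right (Submodule.mem_span_singleton_self x)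
      exact inner_self_eq_zero.1 (hxV x hx)
    have hPn : P (Module.finrank ℝ ↥(V ⊔ ℝ ∙ x)) := by
      refine ⟨insert x s, fun y hy => ?_, ?_, by rw [hspan]⟩
      · rcases Finset.mem_insert.1 hy with rfl | hy
        · exact ⟨μ, hμ, hAx⟩
        · exact hs y hy
      · rw [hspan]
        exact exists_neg_on_sup_span_singleton hA hc hneg hxV hμ hAx
    have hle := Nat.le_findGreatest (hbound _ hPn) hPn
    have hgt := Submodule.finrank_lt_finrank_of_lt hlt
    omega
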